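/- For the matrix-valued map U ↦ ℐ_U defined by ℐ_U(v) = -⨍_{𝕋³} U × Δ⁻¹(∇ × (U × v)) dx on mean-free divergence-free smooth vector fields U on 𝕋³, the matrix ℐ_U is real symmetric: ⟨v, ℐ_U(w)⟩ = ⟨ℐ_U(v), w⟩ for all v, w ∈ ℝ³. -/

import Mathlib

open MeasureTheory

/-- Partial derivative in direction `k`. -/
noncomputable def pd (k : Fin 3) (f : (Fin 3 → ℝ) → ℝ) (x : Fin 3 → ℝ) : ℝ :=
  fderiv ℝ f x (Pi.single k 1)

/-- Curl of a vector field on `ℝ³`. -/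
noncomputable def vcurl (f : (Fin 3 → ℝ) → (Fin 3 → ℝ)) (x : Fin 3 → ℝ) : Fin 3 → ℝ :=
  ![pd 1 (fun y => f y 2) x - pd 2 (fun y => f y 1) x,
    pd 2 (fun y => f y 0) x - pd 0 (fun y => f y 2) x,
    pd 0 (fun y => f y 1) x - pd 1 (fun y => f y 0) x]

/-- Divergence of a vector field on `ℝ³`. -/
noncomputable def vdiv (f : (Fin 3 → ℝ) → (Fin 3 → ℝ)) (x : Fin 3 → ℝ) : ℝ :=
  ∑ k, pd k (fun y => f y k) x

/-- Componentwise Laplacian of a vector field on `ℝ³`. -/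
noncomputable def vlap (f : (Fin 3 → ℝ) → (Fin 3 → ℝ)) (x : Fin 3 → ℝ) : Fin 3 → ℝ :=
  fun i => ∑ k, pd k (fun y => pd k (fun z => f z i) y) x

/-- A fundamental domain of the torus `𝕋³ = ℝ³/(2πℤ)³`. -/
noncomputable def TBox : Set (Fin 3 → ℝ) := Set.univ.pi fun _ => Set.Icc 0 (2 * Real.pi)

/-- Abstract (differential algebra) form of the argument. -/
theorem abs_main {R : Type*} [CommRing R] [Algebra ℝ R] (D : Fin 3 → R →ₗ[ℝ] R) (E : R →ₗ[ℝ] ℝ)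
    (hL : ∀ k f g, D k (f * g) = D k f * g + f * D k g)
    (hC : ∀ k l f, D k (D l f) = D l (D k f))
    (hE : ∀ k f, E (D k f) = 0)
    (hpos : ∀ f, 0 ≤ E (f * f))
    (hzero : ∀ f, E (f * f) = 0 → f = 0)
    (hconst : ∀ f, (∀ k, D k f = 0) → E f = 0 → f = 0)
    (u : Fin 3 → R) (S : (Fin 3 → ℝ) → Fin 3 → R)
    (hdiv : ∑ k, D k (u k) = 0) (hu : ∀ a, E (u a) = 0)
    (hS : ∀ v a, ∑ k, D k (D k (S v a)) = ∑ m, v m • D m (u a)) (v w : Fin 3 → ℝ) :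
    E (v 0 • (u 1 * S w 2 - u 2 * S w 1) + v 1 • (u 2 * S w 0 - u 0 * S w 2)
        + v 2 • (u 0 * S w 1 - u 1 * S w 0))
      = E (w 0 • (u 1 * S v 2 - u 2 * S v 1) + w 1 • (u 2 * S v 0 - u 0 * S v 2)
        + w 2 • (u 0 * S v 1 - u 1 * S v 0)) := by
  have ibp : ∀ k f g, E (D k f * g) = - E (f * D k g) := by
    intro k f g
    have := hE k (f * g)
    rw [hL, map_add] at this
    linarith
  -- Liouville
  have liou : ∀ f, ∑ k, D k (D k f) = 0 → E f = 0 → f = 0 := by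
    intro f hf h0
    refine hconst f ?_ h0
    have h1 : ∑ k, E (D k f * D k f) = 0 := by
      have : E (f * ∑ k, D k (D k f)) = 0 := by rw [hf]; simp
      rw [Finset.mul_sum, map_sum] at this
      rw [← neg_eq_zero, ← this, ← Finset.sum_neg_distrib]
      refine Finset.sum_congr rfl fun k _ => ?_
      rw [ibp]; simp
    intro k
    apply hzero
    exact (Finset.sum_eq_zero_iff_of_nonneg (fun k _ => hpos (D k f))).1 h1 k (Finset.mem_univ _)
  -- mixed derivatives
  let e : Fin 3 → Fin 3 → ℝ := fun j => Pi.single j 1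
  have hSe : ∀ j a, ∑ k, D k (D k (S (e j) a)) = D j (u a) := by
    intro j a
    rw [hS]
    simp [e, Pi.single_apply]
  have mixed : ∀ (z : Fin 3 → ℝ) j a, D j (S z a) = ∑ m, z m • D m (S (e j) a) := by
    intro z j a
    rw [← sub_eq_zero]
    apply liou
    · have h1 : ∑ k, D k (D k (D j (S z a))) = D j (∑ m, z m • D m (u a)) := by
        rw [← hS, map_sum]
        refine Finset.sum_congr rfl fun k _ => ?_
        rw [hC k j, hC k j]
      have h2 : ∑ k, D k (D k (∑ m, z m • D m (S (e j) a))) = ∑ m, z m • D m (D j (u a)) := by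
        simp only [← hSe, map_sum, map_smul, Finset.smul_sum]
        rw [Finset.sum_comm]
        refine Finset.sum_congr rfl fun m _ => Finset.sum_congr rfl fun k _ => ?_
        rw [hC k m, hC k m]
      simp only [map_sub, Finset.sum_sub_distrib, h1, h2]
      simp only [map_sum, map_smul]
      rw [sub_eq_zero]
      refine Finset.sum_congr rfl fun m _ => ?_
      rw [hC]
    · simp [hE]
  have mixe : ∀ k j a, D j (S (e k) a) = D k (S (e j) a) := by
    intro k j a
    rw [mixed]
    simp [e, Pi.single_apply]
  -- reconstruct u
  have hrec : ∀ a, u a = ∑ j, D j (S (e j) a) := by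
    intro a
    rw [← sub_eq_zero]
    apply hconst
    · intro k
      rw [map_sub, map_sum, ← hSe, sub_eq_zero]
      refine Finset.sum_congr rfl fun j _ => ?_
      rw [mixe k j a, hC]
    · simp [hE, hu]
  have hdivS : ∀ j, ∑ a, D a (S (e j) a) = 0 := by
    intro j
    apply liou
    · have : ∑ k, D k (D k (∑ a, D a (S (e j) a))) = ∑ a, D a (D j (u a)) := by
        simp only [← hSe, map_sum]
        rw [Finset.sum_comm]
        refine Finset.sum_congr rfl fun m _ => Finset.sum_congr rfl fun k _ => ?_
        rw [hC k m, hC k m]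
      rw [this]
      calc _ = D j (∑ a, D a (u a)) := by
            rw [map_sum]
            exact Finset.sum_congr rfl fun a _ => hC _ _ _
        _ = 0 := by rw [hdiv]; simp
    · simp [hE]
  have hT : ∀ j b, ∑ m, E (S (e j) m * D m (S (e j) b)) = 0 := by
    intro j b
    have : E ((∑ m, D m (S (e j) m)) * S (e j) b) = 0 := by rw [hdivS]; simp
    rw [Finset.sum_mul, map_sum] at this
    rw [← neg_eq_zero, ← this, ← Finset.sum_neg_distrib]
    refine Finset.sum_congr rfl fun m _ => ?_
    rw [ibp]
  have hanti : ∀ j m a b, E (S (e j) a * D m (S (e j) b)) = - E (S (e j) b * D m (S (e j) a)) := by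
    intro j m a b
    rw [← ibp, mul_comm]
  have key : ∀ (z : Fin 3 → ℝ) a b,
      E (u a * S z b) = - ∑ j, ∑ m, z m * E (S (e j) a * D m (S (e j) b)) := by
    intro z a b
    rw [hrec, Finset.sum_mul, map_sum, ← Finset.sum_neg_distrib]
    refine Finset.sum_congr rfl fun j _ => ?_
    rw [ibp, mixed, Finset.mul_sum, map_sum]
    simp
  simp only [map_add, map_sub, map_smul, key, smul_eq_mul, ← Finset.sum_neg_distrib,
    ← Finset.sum_sub_distrib, Finset.mul_sum, ← Finset.sum_add_distrib]
  refine Finset.sum_congr rfl fun j _ => ?_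
  have t0 := hT j 0
  have t1 := hT j 1
  have t2 := hT j 2
  have d : ∀ m a, E (S (e j) a * D m (S (e j) a)) = 0 := fun m a => by
    have := hanti j m a a
    linarith
  simp only [Fin.sum_univ_three] at *
  have d0 := fun m => hanti j m 1 0
  have d1 := fun m => hanti j m 2 0
  have d2 := fun m => hanti j m 2 1
  simp only [d, d0, d1, d2] at *
  linear_combination 2 * (v 1 * w 0 - v 0 * w 1) * t2 + 2 * (v 0 * w 2 - v 2 * w 0) * t1
    + 2 * (v 2 * w 1 - v 1 * w 2) * t0

noncomputable section

/-- Lattice vector. -/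
def latt (m : Fin 3 → ℤ) : Fin 3 → ℝ := fun i => 2 * Real.pi * (m i : ℝ)

/-- Smooth periodic functions. -/
def PA : Subalgebra ℝ ((Fin 3 → ℝ) → ℝ) where
  carrier := {f | ContDiff ℝ (⊤ : ℕ∞) f ∧ ∀ x m, f (x + latt m) = f x}
  mul_mem' := fun {f g} hf hg => ⟨hf.1.mul hg.1, fun x m => by simp [hf.2, hg.2]⟩
  add_mem' := fun {f g} hf hg => ⟨hf.1.add hg.1, fun x m => by simp [hf.2, hg.2]⟩
  algebraMap_mem' := fun r => ⟨contDiff_const, fun x m => rfl⟩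

theorem PA_smooth (f : PA) : ContDiff ℝ (⊤ : ℕ∞) f.1 := f.2.1
theorem PA_diff (f : PA) : Differentiable ℝ f.1 := f.2.1.differentiable (by simp)
theorem PA_cont (f : PA) : Continuous f.1 := f.2.1.continuous

theorem TBox_eq : TBox = Set.Icc (0 : Fin 3 → ℝ) (fun _ => 2 * Real.pi) := by
  rw [TBox, ← Set.pi_univ_Icc]; rfl

theorem PA_intg (f : PA) : IntegrableOn f.1 TBox := by
  rw [TBox_eq]
  exact (PA_cont f).continuousOn.integrableOn_compact isCompact_Icc

theorem pd_mem (k : Fin 3) (f : PA) : pd k f.1 ∈ PA := by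
  constructor
  · exact ((PA_smooth f).fderiv_right (m := (⊤ : ℕ∞)) (by simp)).clm_apply contDiff_const
  · intro x m
    unfold pd
    rw [← fderiv_comp_add_right]
    congr 2
    ext y
    exact f.2.2 y m

/-- Partial derivative on periodic functions. -/
def DD (k : Fin 3) : PA →ₗ[ℝ] PA where
  toFun f := ⟨pd k f.1, pd_mem k f⟩
  map_add' f g := by
    ext x
    simp only [pd]
    exact congrArg (fun L => L (Pi.single k 1)) (fderiv_add ((PA_diff f) x) ((PA_diff g) x))
  map_smul' c f := by
    ext x
    simp only [pd]
    exact congrArg (fun L => L (Pi.single k 1)) (fderiv_const_smul ((PA_diff f) x) c)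

/-- Integral. -/
def EE : PA →ₗ[ℝ] ℝ where
  toFun f := ∫ x in TBox, f.1 x
  map_add' f g := integral_add (PA_intg f) (PA_intg g)
  map_smul' c f := integral_const_mul c _

theorem DD_mul (k : Fin 3) (f g : PA) : DD k (f * g) = DD k f * g + f * DD k g := by
  ext x
  have := congrArg (fun L => L (Pi.single k 1)) (fderiv_mul ((PA_diff f) x) ((PA_diff g) x))
  refine this.trans ?_
  simp [DD, pd]
  ring

theorem DD_comm (k l : Fin 3) (f : PA) : DD k (DD l f) = DD l (DD k f) := by
  have h : ∀ (k l : Fin 3) x, (DD k (DD l f)).1 x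
      = fderiv ℝ (fderiv ℝ f.1) x (Pi.single k 1) (Pi.single l 1) := by
    intro k l x
    simp only [DD, pd, LinearMap.coe_mk, AddHom.coe_mk]
    have hd : DifferentiableAt ℝ (fderiv ℝ f.1) x :=
      ((PA_smooth f).fderiv_right (m := (⊤ : ℕ∞)) (by simp)).differentiable (by simp) x
    change fderiv ℝ (fun y => fderiv ℝ f.1 y (Pi.single l 1)) x _ = _
    rw [fderiv_clm_apply hd (differentiableAt_const _)]
    simp
  ext x
  rw [h, h]
  exact ((PA_smooth f).contDiffAt.isSymmSndFDerivAt (by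
    rw [minSmoothness_of_isRCLikeNormedField]; exact WithTop.coe_le_coe.2 le_top)) _ _

theorem EE_DD (k : Fin 3) (f : PA) : EE (DD k f) = 0 := by
  have hpi : (0 : ℝ) ≤ 2 * Real.pi := by positivity
  have h := integral_divergence_of_hasFDerivAt_off_countable' (E := ℝ) (n := 2)
    (0 : Fin 3 → ℝ) (fun _ => 2 * Real.pi) (fun _ => hpi)
    (fun i => if i = k then f.1 else 0) (fun i x => if i = k then fderiv ℝ f.1 x else 0) ∅
    Set.countable_empty
    (fun i => by
      split_ifs
      · exact (PA_cont f).continuousOn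
      · exact continuousOn_const)
    (fun x _ i => by
      split_ifs
      · exact ((PA_diff f) x).hasFDerivAt
      · exact hasFDerivAt_const _ _)
    (by
      have := (PA_intg (DD k f))
      rw [TBox_eq] at this
      refine this.congr_fun (fun x _ => ?_) measurableSet_Icc
      rw [Finset.sum_eq_single k]
      · simp [DD, pd]
      · intro b _ hb; simp [hb]
      · simp)
  have h2 : EE (DD k f) = ∫ x in Set.Icc (0 : Fin 3 → ℝ) (fun _ => 2 * Real.pi),
      ∑ i : Fin 3, (if i = k then fderiv ℝ f.1 x else 0) (Pi.single i 1) := by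
    simp only [EE, LinearMap.coe_mk, AddHom.coe_mk]
    rw [TBox_eq]
    refine integral_congr_ae (Filter.Eventually.of_forall fun x => ?_)
    dsimp only
    rw [Finset.sum_eq_single k]
    · simp [DD, pd]
    · intro b _ hb; simp [hb]
    · simp
  rw [h2]
  refine h.trans (Finset.sum_eq_zero fun i _ => ?_)
  rw [sub_eq_zero]
  refine integral_congr_ae (Filter.Eventually.of_forall fun x => ?_)
  dsimp only
  split_ifs
  · rw [← f.2.2 (i.insertNth ((0 : Fin 3 → ℝ) i) x) (Pi.single i 1)]
    refine congrArg f.1 (funext fun j => ?_)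
    refine Fin.succAboveCases i ?_ (fun j => ?_) j
    · simp [latt]
    · simp [latt]
  · rfl

theorem EE_pos (f : PA) : 0 ≤ EE (f * f) :=
  integral_nonneg fun x => mul_self_nonneg (f.1 x)

theorem EE_zero (f : PA) (h : EE (f * f) = 0) : f = 0 := by
  have h1 := (setIntegral_eq_zero_iff_of_nonneg_ae (μ := volume) (s := TBox)
    (Filter.Eventually.of_forall fun x => mul_self_nonneg (f.1 x)) (PA_intg (f * f))).1 h
  have hpi : (0 : ℝ) ≠ 2 * Real.pi := by positivity
  have h2 : Set.EqOn (f * f).1 0 TBox := by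
    refine Measure.eqOn_of_ae_eq h1 (PA_cont (f * f)).continuousOn continuousOn_const ?_
    rw [TBox, interior_pi_set Set.finite_univ, closure_pi_set]
    simp [closure_Ioo hpi]
  ext x
  have hp : (0 : ℝ) < 2 * Real.pi := by positivity
  let m : Fin 3 → ℤ := fun i => - toIcoDiv hp 0 (x i)
  have hx : x + latt m ∈ TBox := by
    intro i _
    have := toIcoMod_mem_Ico hp 0 (x i)
    have he : (x + latt m) i = toIcoMod hp 0 (x i) := by
      rw [toIcoMod]
      simp only [latt, m, Pi.add_apply, zsmul_eq_mul]
      push_cast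
      ring
    rw [he]
    simp only [zero_add] at this
    exact ⟨this.1, this.2.le⟩
  have h3 : f.1 (x + latt m) * f.1 (x + latt m) = 0 := h2 hx
  rw [f.2.2] at h3
  exact mul_self_eq_zero.1 h3

theorem EE_const (f : PA) (hD : ∀ k, DD k f = 0) (h : EE f = 0) : f = 0 := by
  have h1 : ∀ x, fderiv ℝ f.1 x = 0 := by
    intro x
    have h0 : ∀ k, fderiv ℝ f.1 x (Pi.single k 1) = 0 := fun k =>
      congrArg (fun g : PA => g.1 x) (hD k)
    refine ContinuousLinearMap.coe_injective (LinearMap.pi_ext' fun k => LinearMap.ext_ring ?_)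
    simpa using h0 k
  have h2 : ∀ x, f.1 x = f.1 0 := fun x => is_const_of_fderiv_eq_zero (PA_diff f) h1 x 0
  have h3 : EE f = ∫ x in TBox, f.1 0 := by
    simp only [EE, LinearMap.coe_mk, AddHom.coe_mk]
    simp_rw [h2]
  rw [h3, setIntegral_const, smul_eq_mul, mul_eq_zero] at h
  have hv : volume.real TBox ≠ 0 := by
    rw [TBox_eq, Measure.real, Real.volume_Icc_pi_toReal (fun _ => by positivity)]
    simp [Real.pi_ne_zero]
  ext x
  rw [h2]
  exact h.resolve_left hv

end

/-- The alpha-matrix `ℐ_U(v) = -⨍ U × Δ⁻¹(∇×(U×v))` is symmetric.  Here `S v = Δ⁻¹(∇×(U×v))`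
is the mean-free periodic solution of `Δ(S v) = ∇×(U×v)`. -/
theorem alpha_matrix_symmetric
    (U : (Fin 3 → ℝ) → (Fin 3 → ℝ)) (hU : ContDiff ℝ (⊤ : ℕ∞) U)
    (hUper : ∀ (x : Fin 3 → ℝ) (m : Fin 3 → ℤ), U (x + fun i => 2 * Real.pi * (m i : ℝ)) = U x)
    (hUdiv : ∀ x, vdiv U x = 0)
    (hUmean : (∫ x in TBox, U x) = 0)
    (S : (Fin 3 → ℝ) → (Fin 3 → ℝ) → (Fin 3 → ℝ))
    (hSsmooth : ∀ v, ContDiff ℝ (⊤ : ℕ∞) (S v))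
    (hSper : ∀ v (x : Fin 3 → ℝ) (m : Fin 3 → ℤ),
      S v (x + fun i => 2 * Real.pi * (m i : ℝ)) = S v x)
    (hSmean : ∀ v, (∫ x in TBox, S v x) = 0)
    (hSeq : ∀ v x, vlap (S v) x = vcurl (fun y => crossProduct (U y) v) x)
    (Iu : (Fin 3 → ℝ) → (Fin 3 → ℝ))
    (hIu : ∀ v, Iu v = -(((2 * Real.pi) ^ 3)⁻¹ • ∫ x in TBox, crossProduct (U x) (S v x))) :
    ∀ v w : Fin 3 → ℝ, ∑ i, v i * Iu w i = ∑ i, Iu v i * w i := by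
  classical
  let u : Fin 3 → PA := fun a => ⟨fun x => U x a, contDiff_pi.1 hU a,
    fun x m => congrFun (hUper x m) a⟩
  let T : (Fin 3 → ℝ) → Fin 3 → PA := fun v a => ⟨fun x => S v x a, contDiff_pi.1 (hSsmooth v) a,
    fun x m => congrFun (hSper v x m) a⟩
  have hdiv : ∑ k, DD k (u k) = 0 := by
    ext x
    have := hUdiv x
    simp only [vdiv, Fin.sum_univ_three] at this
    simpa [Fin.sum_univ_three, DD, u] using this
  have hUi : ∀ a, IntegrableOn (fun x => U x a) TBox := fun a => (PA_intg (u a))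
  have hu : ∀ a, EE (u a) = 0 := by
    intro a
    have h := congrFun hUmean a
    rw [eval_integral hUi] at h
    exact h
  have hpdU : ∀ (a k : Fin 3) x, pd k (fun y => U y a) x = (DD k (u a)).1 x := fun _ _ _ => rfl
  have hS : ∀ v a, ∑ k, DD k (DD k (T v a)) = ∑ m, v m • DD m (u a) := by
    intro v a
    ext x
    have h := congrFun (hSeq v x) a
    have hl : (∑ k, DD k (DD k (T v a))).1 x = vlap (S v) x a := by
      simp only [vlap, Fin.sum_univ_three]
      rfl
    have hd := congrArg (fun g : PA => g.1 x) hdiv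
    have hlin : ∀ (k i j : Fin 3) (c d : ℝ),
        pd k (fun y => U y i * c - U y j * d) x
          = (DD k (u i)).1 x * c - (DD k (u j)).1 x * d := by
      intro k i j c d
      have h1 : (fun y => U y i * c - U y j * d) = (c • u i - d • u j : PA).1 := by
        ext y
        simp [u, mul_comm]
      rw [h1]
      change (DD k (c • u i - d • u j)).1 x = _
      rw [map_sub, map_smul, map_smul]
      simp [mul_comm]
    refine (hl.trans h).trans ?_
    simp only [Fin.sum_univ_three] at hd ⊢
    simp at hd
    fin_cases a
    · simp [vcurl, cross_apply, hlin]
      linear_combination (-v 0) * hd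
    · simp [vcurl, cross_apply, hlin]
      linear_combination (-v 1) * hd
    · simp [vcurl, cross_apply, hlin]
      linear_combination (-v 2) * hd
  have main := abs_main DD EE DD_mul DD_comm EE_DD EE_pos EE_zero EE_const u T hdiv hu hS
  intro v w
  have hI : ∀ z i, Iu z i = -(((2 * Real.pi) ^ 3)⁻¹ *
      (![EE (u 1 * T z 2 - u 2 * T z 1), EE (u 2 * T z 0 - u 0 * T z 2),
        EE (u 0 * T z 1 - u 1 * T z 0)] : Fin 3 → ℝ) i) := by
    intro z i
    have hc : ∀ i x, crossProduct (U x) (S z x) i = ((![u 1 * T z 2 - u 2 * T z 1,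
        u 2 * T z 0 - u 0 * T z 2, u 0 * T z 1 - u 1 * T z 0] : Fin 3 → PA) i).1 x := by
      intro i x
      rw [cross_apply]
      fin_cases i <;> rfl
    rw [hIu]
    simp only [Pi.neg_apply, Pi.smul_apply, smul_eq_mul]
    rw [eval_integral]
    · simp only [hc]
      fin_cases i <;> rfl
    · intro i
      simp only [hc]
      exact PA_intg _
  have h := main v w
  simp only [map_add, map_smul, smul_eq_mul] at h
  simp only [hI, Fin.sum_univ_three]
  simp only [Matrix.cons_val]
  linear_combination (-((2 * Real.pi) ^ 3)⁻¹) * h
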